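/- arXiv:math/0107231 — 7 statements merged into one kernel-verified Lean document; each statement's English description precedes it below -/
import Mathlib

section
/- B = C(𝕋^n, ℂ) is a free module of rank q over the subalgebra A of F-translation-invariant functions: there exist elements e_1, ..., e_q ∈ B such that every f ∈ B is expressible uniquely as f = Σ_{j=1}^q a_j · e_j with a_1, ..., a_q ∈ A; equivalently, there is an A-module isomorphism from B onto A^q (the q-fold direct sum of A). -/
open scoped Real ComplexConjugate
noncomputable section

/-- The `n`-torus `ℝ^n/ℤ^n`. -/
abbrev Torus (n : ℕ) : Type := Fin n → AddCircle (1 : ℝ)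

/-- `f ∈ C(𝕋^n, ℂ)` is invariant under translation by all elements of `F`. -/
def FInvariant (n : ℕ) (F : AddSubgroup (Torus n)) (f : C(Torus n, ℂ)) : Prop :=
  ∀ (x : Torus n) (w : F), f (x - (w : Torus n)) = f x

/-- A subgroup of the dual of a finite abelian group that separates points is the whole dual. -/
lemma AddChar.eq_top_of_separatesPoints {G : Type*} [AddCommGroup G] [Finite G]
    (H : AddSubgroup (AddChar G ℂ)) (hH : ∀ g : G, (∀ ψ ∈ H, ψ g = 1) → g = 0) : H = ⊤ := by
  refine (AddSubgroup.eq_top_iff' H).2 fun χ ↦ ?_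
  by_contra hχ
  obtain ⟨η, hη⟩ := AddChar.exists_apply_ne_zero.2
    (mt (QuotientAddGroup.eq_zero_iff χ).1 hχ : (χ : AddChar G ℂ ⧸ H) ≠ 0)
  obtain ⟨g, hg⟩ := AddChar.doubleDualEmb_bijective.2
    (η.compAddMonoidHom (QuotientAddGroup.mk' H))
  have key (ψ : AddChar G ℂ) : ψ g = η (ψ : AddChar G ℂ ⧸ H) := DFunLike.congr_fun hg ψ
  have hg0 : g = 0 := hH g fun ψ hψ ↦ by
    rw [key, (QuotientAddGroup.eq_zero_iff ψ).2 hψ, AddChar.map_zero_eq_one]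
  exact hη (by rw [← key, hg0, AddChar.map_zero_eq_one])

/-- The characters of a subgroup `F` of an abelian topological group that extend to continuous
characters of the whole group. -/
def extendableChars {T : Type*} [AddCommGroup T] [TopologicalSpace T] [IsTopologicalAddGroup T]
    (F : AddSubgroup T) : AddSubgroup (AddChar F ℂ) where
  carrier := {χ | ∃ ψ : AddChar T ℂ, Continuous ψ ∧ ∀ w : F, ψ w = χ w}
  zero_mem' := ⟨0, continuous_const, fun _ ↦ rfl⟩
  add_mem' := by
    rintro _ _ ⟨ψ, hψ, h⟩ ⟨ψ', hψ', h'⟩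
    exact ⟨ψ + ψ', hψ.mul hψ', fun w ↦ by simp [h, h']⟩
  neg_mem' := by
    rintro _ ⟨ψ, hψ, h⟩
    exact ⟨-ψ, hψ.comp continuous_neg, fun w ↦ by simp [← h]⟩

/-- The character `x ↦ exp (2πi x_i)` of the torus. -/
def Torus.coordChar {n : ℕ} (i : Fin n) : AddChar (Torus n) ℂ where
  toFun x := (AddCircle.toCircle (x i) : ℂ)
  map_zero_eq_one' := by simp
  map_add_eq_mul' x y := by simp [AddCircle.toCircle_add]

lemma Torus.continuous_coordChar {n : ℕ} (i : Fin n) : Continuous (Torus.coordChar i) :=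
  continuous_subtype_val.comp (AddCircle.continuous_toCircle.comp (continuous_apply i))

/-- Every character of a finite subgroup of the torus extends to a continuous character. -/
lemma Torus.exists_continuous_extension {n : ℕ} (F : AddSubgroup (Torus n)) [Finite F]
    (χ : AddChar F ℂ) : ∃ ψ : AddChar (Torus n) ℂ, Continuous ψ ∧ ∀ w : F, ψ w = χ w := by
  have htop : extendableChars F = ⊤ := by
    refine AddChar.eq_top_of_separatesPoints _ fun w hw ↦ Subtype.ext (funext fun i ↦ ?_)
    have h : Torus.coordChar i (w : Torus n) = 1 :=
      hw ((Torus.coordChar i).compAddMonoidHom F.subtype)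
        ⟨Torus.coordChar i, Torus.continuous_coordChar i, fun _ ↦ rfl⟩
    refine AddCircle.injective_toCircle one_ne_zero (Circle.ext ?_)
    simpa [Torus.coordChar] using h
  exact (AddSubgroup.eq_top_iff' _).1 htop χ

/-- The average of a function over the translations by a finite subgroup. -/
def translationAverage {n : ℕ} (F : AddSubgroup (Torus n)) [Fintype F] (f : C(Torus n, ℂ)) :
    C(Torus n, ℂ) where
  toFun x := (Fintype.card F : ℂ)⁻¹ * ∑ w : F, f (x + w)
  continuous_toFun := by fun_prop

lemma fInvariant_translationAverage {n : ℕ} (F : AddSubgroup (Torus n)) [Fintype F]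
    (f : C(Torus n, ℂ)) : FInvariant n F (translationAverage F f) := by
  intro x w
  simp only [translationAverage, ContinuousMap.coe_mk]
  congr 1
  refine Fintype.sum_equiv (Equiv.subRight w) _ _ fun v ↦ ?_
  congr 1
  simp only [Equiv.subRight_apply, AddSubgroup.coe_sub]
  abel

/-- `B = C(𝕋^n, ℂ)` is a free module of rank `q` over the subalgebra `A` of
`F`-translation-invariant functions: there are `e_1, …, e_q ∈ B` such that every `f ∈ B`
is uniquely expressible as `f = ∑ a_j * e_j` with all `a_j ∈ A`. -/
theorem free_of_rank_card_over_invariants (n q : ℕ) (hn : 1 ≤ n) (hq : 2 ≤ q)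
    (F : AddSubgroup (Torus n)) [Fintype F] (hcard : Fintype.card F = q) :
    ∃ e : Fin q → C(Torus n, ℂ),
      ∀ f : C(Torus n, ℂ),
        ∃! a : Fin q → C(Torus n, ℂ),
          (∀ j, FInvariant n F (a j)) ∧ f = ∑ j, a j * e j := by
  classical
  choose ψ hψ hψF using Torus.exists_continuous_extension F
  let σ : Fin q ≃ AddChar F ℂ :=
    Fintype.equivOfCardEq (by rw [Fintype.card_fin, AddChar.card_eq, hcard])
  have hq0 : (Fintype.card F : ℂ) ≠ 0 := Nat.cast_ne_zero.2 Fintype.card_ne_zero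
  have hadd (χ : AddChar F ℂ) (x : Torus n) (w : F) : ψ χ (x + w) = ψ χ x * χ w := by
    rw [AddChar.map_add_eq_mul, hψF]
  have hneg (χ : AddChar F ℂ) (x : Torus n) (w : F) :
      ψ χ (-(x + w)) = ψ χ (-x) * χ (-w) := by
    rw [neg_add, AddChar.map_add_eq_mul, ← hψF]
    rfl
  have hcancel (χ : AddChar F ℂ) (x : Torus n) : ψ χ (-x) * ψ χ x = 1 := by
    rw [← AddChar.map_add_eq_mul, neg_add_cancel, AddChar.map_zero_eq_one]
  let e (χ : AddChar F ℂ) : C(Torus n, ℂ) := ⟨ψ χ, hψ χ⟩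
  let e' (χ : AddChar F ℂ) : C(Torus n, ℂ) := ⟨fun x ↦ ψ χ (-x), (hψ χ).comp continuous_neg⟩
  refine ⟨fun j ↦ e (σ j), fun f ↦ ⟨fun j ↦ translationAverage F (f * e' (σ j)),
    ⟨fun j ↦ fInvariant_translationAverage F _, ?_⟩, ?_⟩⟩
  · ext x
    rw [σ.sum_comp (fun χ ↦ translationAverage F (f * e' χ) * e χ)]
    simp only [ContinuousMap.sum_apply, ContinuousMap.mul_apply, translationAverage,
      ContinuousMap.coe_mk, e, e', hneg]
    have hterm (χ : AddChar F ℂ) :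
        (Fintype.card F : ℂ)⁻¹ * (∑ w : F, f (x + w) * (ψ χ (-x) * χ (-w))) * ψ χ x =
          ∑ w : F, (Fintype.card F : ℂ)⁻¹ * f (x + w) * χ (-w) := by
      rw [Finset.mul_sum, Finset.sum_mul]
      refine Finset.sum_congr rfl fun w _ ↦ ?_
      linear_combination ((Fintype.card F : ℂ)⁻¹ * f (x + w) * χ (-w)) * hcancel χ x
    simp_rw [hterm]
    rw [Finset.sum_comm]
    simp_rw [← Finset.mul_sum, AddChar.sum_apply_eq_ite, neg_eq_zero]
    simp [mul_right_comm, hq0]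
  · rintro b ⟨hb, hf⟩
    have hinv (i : Fin q) (x : Torus n) (w : F) : b i (x + w) = b i x := by
      rw [← hb i (x + w) w, add_sub_cancel_right]
    funext j
    ext x
    have hterm (w : F) : (f * e' (σ j)) (x + w) =
        ∑ i, b i x * ψ (σ i) x * ψ (σ j) (-x) * (σ i - σ j) w := by
      rw [hf]
      simp only [ContinuousMap.sum_apply, ContinuousMap.mul_apply, ContinuousMap.coe_mk, e, e',
        hneg, hadd, hinv, AddChar.sub_apply, Finset.sum_mul]
      exact Finset.sum_congr rfl fun i _ ↦ by ring
    simp only [translationAverage, ContinuousMap.coe_mk, hterm]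
    rw [Finset.sum_comm]
    simp_rw [← Finset.mul_sum, AddChar.sum_eq_ite, sub_eq_zero, σ.injective.eq_iff]
    simp only [mul_ite, mul_zero, Finset.sum_ite_eq', Finset.mem_univ, if_true]
    field_simp
    linear_combination -(b j x) * hcancel (σ j) x
end
end

section
/- If h_0, h_1, ..., h_{q-1} is an orthonormal family in B (with exactly q elements, q being the order of F), then it is an A-module basis of B: every f ∈ B satisfies the reconstruction formula f = Σ_{j=0}^{q-1} ⟨f, h_j⟩ · h_j, and if a_0, ..., a_{q-1} ∈ A satisfy Σ_{j=0}^{q-1} a_j · h_j = 0 then a_j = 0 for all j. -/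
open scoped Real ComplexConjugate
noncomputable section

/-- The `A`-valued inner product `⟨f, g⟩(x) = ∑_{w ∈ F} f(x−w) conj(g(x−w))`. -/
def innerA (n : ℕ) (F : AddSubgroup (Torus n)) [Fintype F]
    (f g : C(Torus n, ℂ)) : Torus n → ℂ :=
  fun x => ∑ w : F, f (x - (w : Torus n)) * conj (g (x - (w : Torus n)))

open Classical in
/-- If there are as many functions in an orthonormal family as elements of `F`, the square matrix
`(h_j(x−w))_{j,w}` has orthonormal columns. -/
lemma sum_conj_mul_of_orthonormal {n q : ℕ} {F : AddSubgroup (Torus n)} [Fintype F]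
    (hcard : Fintype.card F = q) {h : Fin q → C(Torus n, ℂ)}
    (horth : ∀ j k, innerA n F (h j) (h k) = fun _ => if j = k then (1 : ℂ) else 0)
    (x : Torus n) (v w : F) :
    ∑ j, conj (h j (x - (v : Torus n))) * h j (x - (w : Torus n)) = if v = w then 1 else 0 := by
  let M : Matrix (Fin q) F ℂ := Matrix.of fun j w => h j (x - (w : Torus n))
  have hM : M * M.conjTranspose = 1 := by
    ext j k
    simpa [M, Matrix.mul_apply, Matrix.one_apply, innerA] using congrFun (horth j k) x
  have hM' : M.conjTranspose * M = 1 :=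
    (Matrix.mul_eq_one_comm_of_card_eq _ _ _ (by simp [hcard])).mp hM
  simpa [M, Matrix.mul_apply, Matrix.one_apply] using congrFun (congrFun hM' v) w

/-- An orthonormal family `h_0, …, h_{q-1}` in `B` (with `q` the order of `F`) is an
`A`-module basis of `B`: every `f` satisfies the reconstruction formula
`f = ∑_j ⟨f, h_j⟩ h_j`, and the `h_j` are `A`-linearly independent. -/
theorem orthonormal_family_is_basis (n q : ℕ) (hn : 1 ≤ n) (hq : 2 ≤ q)
    (F : AddSubgroup (Torus n)) [Fintype F] (hcard : Fintype.card F = q)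
    (h : Fin q → C(Torus n, ℂ))
    (horth : ∀ j k, innerA n F (h j) (h k) = fun _ => if j = k then (1 : ℂ) else 0) :
    (∀ (f : C(Torus n, ℂ)) (x : Torus n), f x = ∑ j, innerA n F f (h j) x * h j x) ∧
      ∀ a : Fin q → C(Torus n, ℂ), (∀ j, FInvariant n F (a j)) →
        ∑ j, a j * h j = 0 → ∀ j, a j = 0 := by
  classical
  refine ⟨fun f x => ?_, fun a ha hsum k => ?_⟩
  · have key (w : F) : ∑ j, conj (h j (x - (w : Torus n))) * h j x = if w = 0 then 1 else 0 := by
      simpa using sum_conj_mul_of_orthonormal hcard horth x w 0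
    simp only [innerA, Finset.sum_mul]
    rw [Finset.sum_comm]
    simp [mul_assoc, ← Finset.mul_sum, key]
  · ext x
    have hzero (y : Torus n) : ∑ j, a j y * h j y = 0 := by
      simpa using DFunLike.congr_fun hsum y
    calc a k x = ∑ j, a j x * innerA n F (h j) (h k) x := by simp [horth]
      _ = ∑ w : F, (∑ j, a j (x - (w : Torus n)) * h j (x - (w : Torus n))) *
            conj (h k (x - (w : Torus n))) := by
          simp only [innerA, Finset.mul_sum, Finset.sum_mul]
          rw [Finset.sum_comm]
          refine Finset.sum_congr rfl fun w _ => Finset.sum_congr rfl fun j _ => ?_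
          rw [ha j x w, mul_assoc]
      _ = 0 := by simp [hzero]
end
end

section
/- Suppose h_0 ∈ B satisfies h_0(0) = 1 and ⟨h_0, h_0⟩ = 1 (the constant function 1), i.e. h_0 is a normalized continuous low-pass filter. If q = 2 or n < 2q − 1, then there exist continuous functions h_1, ..., h_{q-1} ∈ B such that the family h_0, h_1, ..., h_{q-1} is orthonormal (i.e. h_1, ..., h_{q-1} is a family of continuous high-pass filters corresponding to h_0). -/
open scoped Real ComplexConjugate
noncomputable section

/-- A monomial on the torus restricts to an additive character. -/
def mFourierAddChar {n : ℕ} (F : AddSubgroup (Torus n)) (m : Fin n → ℤ) : AddChar F ℂ where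
  toFun w := UnitAddTorus.mFourier m (w : Torus n)
  map_zero_eq_one' := by simp [UnitAddTorus.mFourier]
  map_add_eq_mul' x y := by
    simp [UnitAddTorus.mFourier, fourier_apply, AddCircle.toCircle_add, Finset.prod_mul_distrib,
      smul_add]

/-- Every character of a finite subgroup of the torus extends to a monomial. -/
theorem exists_mFourierAddChar_eq {n : ℕ} (F : AddSubgroup (Torus n)) [Fintype F]
    (χ : AddChar F ℂ) : ∃ m, mFourierAddChar F m = χ := by
  by_contra! hχ
  let L : C(Torus n, ℂ) →L[ℂ] ℂ :=
    ∑ w : F, conj (χ w) • ContinuousMap.evalCLM ℂ (w : Torus n)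
  have hLapp (f : C(Torus n, ℂ)) : L f = ∑ w : F, conj (χ w) * f w := by
    simp [L]
  have hL : L = 0 := by
    refine ContinuousLinearMap.ext_on
      (Submodule.dense_iff_topologicalClosure_eq_top.mpr
        (UnitAddTorus.span_mFourier_closure_eq_top (d := Fin n))) ?_
    rintro _ ⟨m, rfl⟩
    have h := AddChar.wInner_cWeight_eq_zero_iff_ne.mpr (hχ m).symm
    rw [RCLike.wInner_cWeight_eq_expect, Fintype.expect_eq_sum_div_card, div_eq_zero_iff] at h
    have h' := h.resolve_right (by simp)
    simp only [RCLike.inner_apply'] at h'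
    rw [hLapp]
    exact h'
  obtain ⟨f, hf⟩ := ContinuousMap.exists_restrict_eq
    (s := (F : Set (Torus n))) (Set.toFinite _).isClosed
    ⟨fun w => χ w, continuous_of_discreteTopology⟩
  have hfw (w : F) : f w = χ w := DFunLike.congr_fun hf w
  have h1 : L f = Fintype.card F := by
    rw [hLapp]
    have (w : F) : conj (χ w) * f w = 1 := by
      rw [hfw, RCLike.conj_mul, χ.norm_apply]; simp
    simp [this]
  rw [hL] at h1
  exact Nat.cast_ne_zero.mpr Fintype.card_ne_zero h1.symm

/-- The monomials indexed by characters of `F` yield an orthonormal family of size `|F|`. -/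
theorem exists_innerA_orthonormal {n : ℕ} (F : AddSubgroup (Torus n)) [Fintype F] :
    ∃ e : Fin (Fintype.card F) → C(Torus n, ℂ),
      ∀ j k x, innerA n F (e j) (e k) x = if j = k then 1 else 0 := by
  choose m hm using exists_mFourierAddChar_eq F
  let σ : Fin (Fintype.card F) ≃ AddChar F ℂ :=
    Fintype.equivOfCardEq (by rw [Fintype.card_fin, AddChar.card_eq])
  have hsub (k : Fin n → ℤ) (x y : Torus n) :
      UnitAddTorus.mFourier k (x - y) =
        UnitAddTorus.mFourier k x * conj (UnitAddTorus.mFourier k y) := by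
    simp only [UnitAddTorus.mFourier, ContinuousMap.coe_mk, map_prod, fourier_apply, Pi.add_apply,
      Pi.neg_apply, sub_eq_add_neg, smul_add, smul_neg, AddCircle.toCircle_add, AddCircle.toCircle_neg,
      Circle.coe_mul, Circle.coe_inv_eq_conj, Finset.prod_mul_distrib]
  have hunit (k : Fin n → ℤ) (x : Torus n) :
      UnitAddTorus.mFourier k x * conj (UnitAddTorus.mFourier k x) = 1 := by
    rw [← hsub, sub_self]
    simp [UnitAddTorus.mFourier]
  refine ⟨fun j => (((√(Fintype.card F))⁻¹ : ℝ) : ℂ) • UnitAddTorus.mFourier (m (σ j)), ?_⟩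
  intro j k x
  have hval (χ : AddChar F ℂ) (w : F) : UnitAddTorus.mFourier (m χ) (w : Torus n) = χ w :=
    DFunLike.congr_fun (hm χ) w
  have horth := AddChar.wInner_cWeight_eq_boole (σ j) (σ k)
  rw [RCLike.wInner_cWeight_eq_expect, Fintype.expect_eq_sum_div_card] at horth
  simp only [RCLike.inner_apply', EmbeddingLike.apply_eq_iff_eq] at horth
  have hs : (((√(Fintype.card F))⁻¹ : ℝ) : ℂ) * (((√(Fintype.card F))⁻¹ : ℝ) : ℂ)
      = (Fintype.card F : ℂ)⁻¹ := by
    rw [← Complex.ofReal_mul, ← mul_inv, Real.mul_self_sqrt (by positivity)]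
    simp
  have key : innerA n F ((((√(Fintype.card F))⁻¹ : ℝ) : ℂ) • UnitAddTorus.mFourier (m (σ j)))
      ((((√(Fintype.card F))⁻¹ : ℝ) : ℂ) • UnitAddTorus.mFourier (m (σ k))) x =
      (UnitAddTorus.mFourier (m (σ j)) x * conj (UnitAddTorus.mFourier (m (σ k)) x)) *
        ((∑ w : F, conj (σ j w) * σ k w) / Fintype.card F) := by
    rw [innerA, div_eq_mul_inv, ← hs, Finset.sum_mul, Finset.mul_sum]
    refine Finset.sum_congr rfl fun w _ => ?_
    simp only [ContinuousMap.smul_apply, smul_eq_mul, hsub, hval, map_mul, Complex.conj_ofReal,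
      Complex.conj_conj]
    ring
  rw [key, horth]
  split_ifs with h
  · rw [h, hunit, one_mul]
  · rw [mul_zero]

section Reflection

variable {E : Type*} [NormedAddCommGroup E] [InnerProductSpace ℂ E]

/-- The complex reflection along `u - v`, carrying `u` to `v` when `u ≠ v` are unit vectors. -/
def complexReflection (u v y : E) : E :=
  y - (inner ℂ (u - v) y / inner ℂ (u - v) u) • (u - v)

theorem inner_sub_left_self_ne_zero {u v : E} (hu : ‖u‖ = 1) (hv : ‖v‖ = 1) (huv : u ≠ v) :
    inner ℂ (u - v) u ≠ 0 := by
  intro h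
  rw [inner_sub_left, inner_self_eq_norm_sq_to_K, hu, sub_eq_zero] at h
  refine huv ((inner_eq_one_iff_of_norm_eq_one (𝕜 := ℂ) hv hu).mp ?_).symm
  rw [← h]; simp

theorem complexReflection_apply_left {u v : E} (hu : ‖u‖ = 1) (hv : ‖v‖ = 1) (huv : u ≠ v) :
    complexReflection u v u = v := by
  rw [complexReflection, div_self (inner_sub_left_self_ne_zero hu hv huv), one_smul, sub_sub_cancel]

theorem inner_complexReflection {u v : E} (hu : ‖u‖ = 1) (hv : ‖v‖ = 1) (huv : u ≠ v) (y z : E) :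
    inner ℂ (complexReflection u v y) (complexReflection u v z) = inner ℂ y z := by
  have h0 := inner_sub_left_self_ne_zero hu hv huv
  have h0' : inner ℂ u (u - v) ≠ 0 := by
    rw [← inner_conj_symm]; exact (map_ne_zero _).mpr h0
  have hw : inner ℂ (u - v) (u - v) = inner ℂ (u - v) u + inner ℂ u (u - v) := by
    rw [inner_sub_right (u - v) u v, inner_sub_left u v v, inner_sub_right u u v,
      inner_self_eq_norm_sq_to_K, inner_self_eq_norm_sq_to_K, hu, hv]
    ring
  unfold complexReflection
  generalize u - v = w at *
  simp only [inner_sub_left, inner_sub_right, inner_smul_left, inner_smul_right, map_div₀,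
    inner_conj_symm, hw]
  field_simp
  ring

theorem Continuous.complexReflection {X : Type*} [TopologicalSpace X] {u v y : X → E}
    (hu : Continuous u) (hv : Continuous v) (hy : Continuous y)
    (hu1 : ∀ x, ‖u x‖ = 1) (hv1 : ∀ x, ‖v x‖ = 1) (huv : ∀ x, u x ≠ v x) :
    Continuous fun x => complexReflection (u x) (v x) (y x) := by
  unfold _root_.complexReflection
  refine hy.sub (Continuous.smul (Continuous.div ?_ ?_ fun x =>
    inner_sub_left_self_ne_zero (hu1 x) (hv1 x) (huv x)) (hu.sub hv)) <;> fun_prop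

/-- A continuous unit vector field `a` extends to a continuous orthonormal frame as soon as there
is a continuous unit vector field `g` that never meets `a` nor some fixed unit vector `e`. The
frame depends only on the values of `a` and `g`. -/
theorem exists_orthonormal_frame_extension {X ι : Type*} [TopologicalSpace X] [Fintype ι]
    [FiniteDimensional ℂ E] (hι : Module.finrank ℂ E = Fintype.card ι) (i₀ : ι)
    {a g : X → E} (ha : Continuous a) (hg : Continuous g) (ha1 : ∀ x, ‖a x‖ = 1)
    (hg1 : ∀ x, ‖g x‖ = 1) (hga : ∀ x, g x ≠ a x) {e : E} (he : ‖e‖ = 1) (hge : ∀ x, e ≠ g x) :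
    ∃ U : ι → X → E, U i₀ = a ∧ (∀ j, Continuous (U j)) ∧ (∀ x, Orthonormal ℂ fun j => U j x) ∧
      ∀ x y, a x = a y → g x = g y → ∀ j, U j x = U j y := by
  obtain ⟨b, hb⟩ := Orthonormal.exists_orthonormalBasis_extension_of_card_eq (𝕜 := ℂ) hι
    (v := fun _ : ι => e) (s := {i₀}) (by
      refine ⟨fun _ => he, fun i j hij => (hij (Subsingleton.elim i j)).elim⟩)
  refine ⟨fun j x => complexReflection (g x) (a x) (complexReflection e (g x) (b j)), ?_, ?_, ?_, ?_⟩
  · funext x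
    dsimp only
    rw [hb i₀ rfl, complexReflection_apply_left he (hg1 x) (hge x),
      complexReflection_apply_left (hg1 x) (ha1 x) (hga x)]
  · exact fun j => hg.complexReflection ha (continuous_const.complexReflection hg continuous_const
      (fun _ => he) hg1 hge) hg1 ha1 hga
  · intro x
    classical
    rw [orthonormal_iff_ite]
    intro j k
    rw [inner_complexReflection (hg1 x) (ha1 x) (hga x), inner_complexReflection he (hg1 x) (hge x)]
    exact orthonormal_iff_ite.mp b.orthonormal j k
  · intro x y hxy hxy' j
    simp only [hxy, hxy']

end Reflection

/-- Continuous functions on the torus whose lift to `ℝ^n` is continuously differentiable. -/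
def contDiffLift (n : ℕ) : Submodule ℂ C(Torus n, ℂ) where
  carrier := {f | ContDiff ℝ 1 fun t : Fin n → ℝ => f fun i => (t i : AddCircle (1 : ℝ))}
  zero_mem' := contDiff_const (𝕜 := ℝ) (n := 1) (c := (0 : ℂ))
  add_mem' hf hg := ContDiff.add (𝕜 := ℝ) (n := 1) (F := ℂ) hf hg
  smul_mem' c _ hf := ContDiff.const_smul (𝕜 := ℝ) (n := 1) (F := ℂ) c hf

theorem dense_contDiffLift (n : ℕ) : Dense (contDiffLift n : Set C(Torus n, ℂ)) := by
  refine (Submodule.dense_iff_topologicalClosure_eq_top.mpr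
    (UnitAddTorus.span_mFourier_closure_eq_top (d := Fin n))).mono ?_
  rw [SetLike.coe_subset_coe, Submodule.span_le]
  rintro _ ⟨m, rfl⟩
  change ContDiff ℝ 1 fun t : Fin n → ℝ => _
  simp only [UnitAddTorus.mFourier, ContinuousMap.coe_mk, fourier_coe_apply]
  refine contDiff_prod fun i _ => ContDiff.cexp ?_
  have : ContDiff ℝ 1 fun t : Fin n → ℝ => ((t i : ℝ) : ℂ) :=
    Complex.ofRealCLM.contDiff.comp (contDiff_apply ℝ ℝ i)
  fun_prop

/-- The average of `f` over the translates by the subgroup `F`. -/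
def translateAverage {n : ℕ} (F : AddSubgroup (Torus n)) [Fintype F] (f : C(Torus n, ℂ)) :
    C(Torus n, ℂ) where
  toFun x := (Fintype.card F : ℂ)⁻¹ * ∑ w : F, f (x - (w : Torus n))
  continuous_toFun := by fun_prop

theorem sum_translate_sub {n : ℕ} (F : AddSubgroup (Torus n)) [Fintype F] {M : Type*}
    [AddCommMonoid M] (f : Torus n → M) (x : Torus n) (v : F) :
    ∑ w : F, f (x - (v : Torus n) - (w : Torus n)) = ∑ w : F, f (x - (w : Torus n)) :=
  Fintype.sum_equiv (Equiv.addLeft v) _ _ fun w => by simp [sub_sub]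

theorem translateAverage_sub {n : ℕ} (F : AddSubgroup (Torus n)) [Fintype F] (f : C(Torus n, ℂ))
    (x : Torus n) (v : F) :
    translateAverage F f (x - (v : Torus n)) = translateAverage F f x := by
  simp only [translateAverage, ContinuousMap.coe_mk, sum_translate_sub F f x v]

theorem translateAverage_mem_contDiffLift {n : ℕ} (F : AddSubgroup (Torus n)) [Fintype F]
    {f : C(Torus n, ℂ)} (hf : f ∈ contDiffLift n) : translateAverage F f ∈ contDiffLift n := by
  change ContDiff ℝ 1 fun t : Fin n → ℝ => _
  simp only [translateAverage, ContinuousMap.coe_mk]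
  refine contDiff_const.mul (ContDiff.sum fun w _ => ?_)
  choose s hs using fun i => QuotientAddGroup.mk_surjective ((w : Torus n) i)
  have hw : (w : Torus n) = fun i => ((s i : ℝ) : AddCircle (1 : ℝ)) := funext fun i => (hs i).symm
  rw [hw]
  exact ContDiff.comp (g := fun t : Fin n → ℝ => f fun i => (t i : AddCircle (1 : ℝ))) hf
    (contDiff_id.sub contDiff_const)

theorem norm_translateAverage_sub_lt {n : ℕ} (F : AddSubgroup (Torus n)) [Fintype F]
    {f a : C(Torus n, ℂ)} {ε : ℝ} (hfa : ∀ x, ‖f x - a x‖ < ε)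
    (ha : ∀ x, ∀ w : F, a (x - (w : Torus n)) = a x) (x : Torus n) :
    ‖translateAverage F f x - a x‖ < ε := by
  have hc : (0 : ℝ) < Fintype.card F := by exact_mod_cast Fintype.card_pos
  have hc' : (Fintype.card F : ℂ) ≠ 0 := by exact_mod_cast hc.ne'
  have h : translateAverage F f x - a x =
      (Fintype.card F : ℂ)⁻¹ * ∑ w : F, (f (x - (w : Torus n)) - a (x - (w : Torus n))) := by
    simp only [translateAverage, ContinuousMap.coe_mk, ha, Finset.sum_sub_distrib,
      Finset.sum_const, Finset.card_univ, nsmul_eq_mul]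
    field_simp
  rw [h, norm_mul, norm_inv, Complex.norm_natCast, inv_mul_lt_iff₀ hc]
  calc ‖∑ w : F, (f (x - (w : Torus n)) - a (x - (w : Torus n)))‖
      ≤ ∑ w : F, ‖f (x - (w : Torus n)) - a (x - (w : Torus n))‖ := norm_sum_le _ _
    _ < ∑ _w : F, ε := Finset.sum_lt_sum_of_nonempty Finset.univ_nonempty fun w _ => hfa _
    _ = Fintype.card F * ε := by simp

/-- Invariant continuous functions are approximated by invariant continuously differentiable
ones. -/
theorem exists_contDiffLift_invariant_approx {n : ℕ} (F : AddSubgroup (Torus n)) [Fintype F]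
    (a : C(Torus n, ℂ)) (ha : ∀ x, ∀ w : F, a (x - (w : Torus n)) = a x) {ε : ℝ} (hε : 0 < ε) :
    ∃ b ∈ contDiffLift n, (∀ x, ∀ w : F, b (x - (w : Torus n)) = b x) ∧
      ∀ x, ‖b x - a x‖ < ε := by
  obtain ⟨f, hf, hfa⟩ := (dense_contDiffLift n).exists_dist_lt a hε
  refine ⟨translateAverage F f, translateAverage_mem_contDiffLift F hf, translateAverage_sub F f,
    norm_translateAverage_sub_lt F (fun x => ?_) ha⟩
  rw [← dist_eq_norm, dist_comm]
  exact (ContinuousMap.dist_apply_le_dist x).trans_lt hfa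

/-- A `C¹` map from the torus to `ℂ^ι` misses a ray when `n + 1 < 2 |ι|`. -/
theorem exists_unit_ne_real_smul {n : ℕ} {ι : Type*} [Fintype ι] (hdim : n + 1 < 2 * Fintype.card ι)
    (b : ι → C(Torus n, ℂ)) (hb : ∀ i, b i ∈ contDiffLift n) :
    ∃ e : EuclideanSpace ℂ ι, ‖e‖ = 1 ∧
      ∀ (x : Torus n) (t : ℝ), e ≠ t • WithLp.toLp 2 fun i => b i x := by
  let G : (Fin n → ℝ) × ℝ → EuclideanSpace ℂ ι := fun p =>
    p.2 • WithLp.toLp 2 fun i => b i fun k => (p.1 k : AddCircle (1 : ℝ))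
  have hG : ContDiff ℝ 1 G := by
    refine contDiff_snd.smul ((PiLp.contDiff_toLp (𝕜 := ℝ)).comp (contDiff_pi.mpr fun i => ?_))
    exact ContDiff.comp (g := fun t : Fin n → ℝ => b i fun k => (t k : AddCircle (1 : ℝ))) (hb i)
      contDiff_fst
  have hrank : Module.finrank ℝ ((Fin n → ℝ) × ℝ) < Module.finrank ℝ (EuclideanSpace ℂ ι) := by
    rw [← Module.finrank_mul_finrank ℝ ℂ (EuclideanSpace ℂ ι)]
    simpa using hdim
  obtain ⟨p, hp⟩ := (hG.dense_compl_range_of_finrank_lt_finrank hrank).nonempty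
  have hp' (x : Torus n) (t : ℝ) : p ≠ t • WithLp.toLp 2 fun i => b i x := by
    rintro rfl
    choose s hs using fun i => QuotientAddGroup.mk_surjective (x i)
    obtain rfl : (fun i => ((s i : ℝ) : AddCircle (1 : ℝ))) = x := funext hs
    exact hp ⟨(s, t), rfl⟩
  have hp0 : p ≠ 0 := fun h => hp' 0 0 (by rw [h, zero_smul])
  refine ⟨(‖p‖⁻¹ : ℝ) • p, ?_, fun x t h => hp' x (‖p‖ * t) ?_⟩
  · rw [norm_smul, norm_inv, norm_norm, inv_mul_cancel₀ (norm_ne_zero_iff.mpr hp0)]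
  · rw [mul_smul, ← h, smul_inv_smul₀ (norm_ne_zero_iff.mpr hp0)]

/-- Below the critical dimension, an invariant unit vector field on the torus is the first row of
an invariant unitary-matrix-valued function. -/
theorem exists_invariant_unitary_frame {n q : ℕ} (hq : 2 ≤ q) (F : AddSubgroup (Torus n))
    [Fintype F] (hdim : n + 1 < 2 * q) (a : Fin q → C(Torus n, ℂ))
    (ha : ∀ j x, ∀ w : F, a j (x - (w : Torus n)) = a j x)
    (ha1 : ∀ x, ∑ l, a l x * conj (a l x) = 1) :
    ∃ U : Fin q → Fin q → C(Torus n, ℂ), U ⟨0, by omega⟩ = a ∧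
      (∀ j l x, ∀ w : F, U j l (x - (w : Torus n)) = U j l x) ∧
      ∀ j k x, ∑ l, U j l x * conj (U k l x) = if j = k then 1 else 0 := by
  have hq0 : (0 : ℝ) < q := by positivity
  choose b hbs hbF hba using fun j => exists_contDiffLift_invariant_approx F (-a j)
    (fun x w => by simp [ha]) (inv_pos.mpr hq0)
  obtain ⟨e, he, hbe⟩ := exists_unit_ne_real_smul (by simpa using hdim) b hbs
  let A : Torus n → EuclideanSpace ℂ (Fin q) := fun x => WithLp.toLp 2 fun i => a i x
  let B : Torus n → EuclideanSpace ℂ (Fin q) := fun x => WithLp.toLp 2 fun i => b i x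
  have hA : Continuous A := (PiLp.continuous_toLp 2 _).comp (by fun_prop)
  have hB : Continuous B := (PiLp.continuous_toLp 2 _).comp (by fun_prop)
  have hA1 (x : Torus n) : ‖A x‖ = 1 := by
    rw [← sq_eq_sq₀ (norm_nonneg _) zero_le_one, EuclideanSpace.norm_sq_eq]
    have := ha1 x
    simp only [Complex.mul_conj, Complex.normSq_eq_norm_sq] at this
    rw [one_pow]
    exact_mod_cast this
  have hBA (x : Torus n) : ‖B x + A x‖ < 1 := by
    have hle : ‖B x + A x‖ ^ 2 < 1 := by
      rw [EuclideanSpace.norm_sq_eq]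
      have : Nonempty (Fin q) := ⟨⟨0, by omega⟩⟩
      calc ∑ i, ‖(B x + A x) i‖ ^ 2 < ∑ _i : Fin q, (q : ℝ)⁻¹ := by
            refine Finset.sum_lt_sum_of_nonempty Finset.univ_nonempty fun i _ => ?_
            have h := hba i x
            rw [ContinuousMap.neg_apply, sub_neg_eq_add] at h
            have h1 : (q : ℝ)⁻¹ ≤ 1 := inv_le_one_of_one_le₀ (by exact_mod_cast (by omega : 1 ≤ q))
            calc ‖b i x + a i x‖ ^ 2 ≤ ‖b i x + a i x‖ :=
                  pow_le_of_le_one (norm_nonneg _) (h.le.trans h1) two_ne_zero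
              _ < _ := h
        _ = 1 := by simp [hq0.ne']
    exact (sq_lt_one_iff₀ (norm_nonneg _)).mp hle
  have hB0 (x : Torus n) : ‖B x‖ ≠ 0 := by
    intro h
    have := hBA x
    rw [norm_eq_zero.mp h, zero_add, hA1] at this
    exact this.false
  have hne (x : Torus n) : ‖B x‖⁻¹ • B x ≠ A x := by
    intro h
    have hBx : B x = ‖B x‖ • A x := by rw [← h, smul_inv_smul₀ (hB0 x)]
    have h1 : ‖B x + A x‖ = ‖B x‖ + 1 := by
      calc ‖B x + A x‖ = ‖(‖B x‖ + 1) • A x‖ := by rw [add_smul, one_smul, ← hBx]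
        _ = ‖B x‖ + 1 := by rw [norm_smul, hA1, mul_one, Real.norm_of_nonneg (by positivity)]
    linarith [hBA x, norm_nonneg (B x)]
  obtain ⟨U, hU0, hUc, hUo, hUi⟩ := exists_orthonormal_frame_extension
    (E := EuclideanSpace ℂ (Fin q)) (ι := Fin q) (by simp) ⟨0, by omega⟩ (a := A)
    (g := fun x => ‖B x‖⁻¹ • B x) hA ((hB.norm.inv₀ hB0).smul hB) hA1
    (fun x => by rw [norm_smul, norm_inv, norm_norm, inv_mul_cancel₀ (hB0 x)]) hne he
    (fun x => hbe x _)
  refine ⟨fun j l => ⟨fun x => U j x l, by have := hUc j; fun_prop⟩, ?_, ?_, ?_⟩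
  · ext l x
    exact congrArg (fun v => v l) (congrFun hU0 x)
  · intro j l x w
    refine congrArg (fun v => v l) (hUi _ _ ?_ ?_ j)
    · simp only [A, ha]
    · simp only [B, hbF]
  · intro j k x
    have h := orthonormal_iff_ite.mp (hUo x) k j
    rw [PiLp.inner_apply] at h
    simp only [RCLike.inner_apply, eq_comm (a := k)] at h
    exact h

/-- In rank two, an invariant unit vector field is the first row of an invariant
unitary-matrix-valued function, in every dimension. -/
theorem exists_invariant_unitary_frame_two {n q : ℕ} (hq : q = 2) (F : AddSubgroup (Torus n))
    [Fintype F] (a : Fin q → C(Torus n, ℂ))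
    (ha : ∀ j x, ∀ w : F, a j (x - (w : Torus n)) = a j x)
    (ha1 : ∀ x, ∑ l, a l x * conj (a l x) = 1) :
    ∃ U : Fin q → Fin q → C(Torus n, ℂ), U ⟨0, by omega⟩ = a ∧
      (∀ j l x, ∀ w : F, U j l (x - (w : Torus n)) = U j l x) ∧
      ∀ j k x, ∑ l, U j l x * conj (U k l x) = if j = k then 1 else 0 := by
  subst hq
  refine ⟨![a, ![-star (a 1), star (a 0)]], rfl, ?_, ?_⟩
  · intro j l x w
    fin_cases j <;> fin_cases l <;> simp [ha]
  · intro j k x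
    have h := ha1 x
    rw [Fin.sum_univ_two] at h
    fin_cases j <;> fin_cases k <;> simp [Fin.sum_univ_two]
    · exact h
    · ring
    · ring
    · linear_combination h

/-- In an orthonormal basis `e`, `innerA` of combinations with invariant coefficients is the
pointwise Hermitian product of the coefficients. -/
theorem innerA_sum_mul {n : ℕ} {ι : Type*} [Fintype ι] [DecidableEq ι] (F : AddSubgroup (Torus n))
    [Fintype F] {e : ι → C(Torus n, ℂ)}
    (he : ∀ j k x, innerA n F (e j) (e k) x = if j = k then 1 else 0) {u v : ι → C(Torus n, ℂ)}
    (hu : ∀ l x, ∀ w : F, u l (x - (w : Torus n)) = u l x)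
    (hv : ∀ l x, ∀ w : F, v l (x - (w : Torus n)) = v l x) (x : Torus n) :
    innerA n F (∑ l, u l * e l) (∑ l, v l * e l) x = ∑ l, u l x * conj (v l x) := by
  calc innerA n F (∑ l, u l * e l) (∑ l, v l * e l) x
      = ∑ l, ∑ m, u l x * conj (v m x) * innerA n F (e l) (e m) x := by
        simp only [innerA, ContinuousMap.sum_apply, ContinuousMap.mul_apply, hu, hv, map_sum,
          map_mul]
        simp only [Finset.sum_mul_sum]
        simp only [Finset.mul_sum]
        rw [Finset.sum_comm]
        refine Finset.sum_congr rfl fun l _ => ?_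
        rw [Finset.sum_comm]
        exact Finset.sum_congr rfl fun m _ => Finset.sum_congr rfl fun w _ => by ring
    _ = ∑ l, u l x * conj (v l x) := by simp [he]

/-- An orthonormal family of size `|F|` is a basis: every function is recovered from its
coefficients. -/
theorem sum_innerA_mul_eq {n : ℕ} {ι : Type*} [Fintype ι] [DecidableEq ι] (F : AddSubgroup (Torus n))
    [Fintype F] (hcard : Fintype.card ι = Fintype.card F) {e : ι → C(Torus n, ℂ)}
    (he : ∀ j k x, innerA n F (e j) (e k) x = if j = k then 1 else 0) (f : C(Torus n, ℂ))
    (x : Torus n) : ∑ l, innerA n F f (e l) x * e l x = f x := by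
  classical
  let M : Matrix ι F ℂ := fun j w => e j (x - (w : Torus n))
  have hM : M * M.conjTranspose = 1 := by
    ext j k
    rw [Matrix.mul_apply, Matrix.one_apply, ← he j k x]
    rfl
  have hM' := (Matrix.mul_eq_one_comm_of_card_eq _ _ _ hcard).mp hM
  have hMw (w : F) : ∑ l, conj (e l (x - (w : Torus n))) * e l x = if w = 0 then 1 else 0 := by
    have := congrFun (congrFun hM' w) 0
    rw [Matrix.mul_apply, Matrix.one_apply] at this
    rw [← this]
    refine Finset.sum_congr rfl fun l _ => ?_
    change _ = conj (e l (x - (w : Torus n))) * e l (x - ((0 : F) : Torus n))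
    rw [ZeroMemClass.coe_zero, sub_zero]
  calc ∑ l, innerA n F f (e l) x * e l x
      = ∑ w : F, f (x - (w : Torus n)) * ∑ l, conj (e l (x - (w : Torus n))) * e l x := by
        simp only [innerA, Finset.sum_mul, Finset.mul_sum, mul_assoc]
        exact Finset.sum_comm
    _ = f x := by simp [hMw]

/-- If `h_0` is a normalized continuous low-pass filter (`h_0(0) = 1`, `⟨h_0, h_0⟩ = 1`)
and either `q = 2` or `n < 2q − 1`, then there exists a family of continuous high-pass
filters `h_1, …, h_{q-1}` making `h_0, h_1, …, h_{q-1}` an orthonormal family. -/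
theorem exists_highpass_filters (n q : ℕ) (hn : 1 ≤ n) (hq : 2 ≤ q)
    (F : AddSubgroup (Torus n)) [Fintype F] (hcard : Fintype.card F = q)
    (h0 : C(Torus n, ℂ)) (hlow : h0 0 = 1)
    (hnorm : innerA n F h0 h0 = fun _ => 1)
    (hdim : q = 2 ∨ n < 2 * q - 1) :
    ∃ h : Fin q → C(Torus n, ℂ), h ⟨0, by omega⟩ = h0 ∧
      ∀ j k, innerA n F (h j) (h k) = fun _ => if j = k then (1 : ℂ) else 0 := by
  obtain ⟨e, he⟩ : ∃ e : Fin q → C(Torus n, ℂ),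
      ∀ j k x, innerA n F (e j) (e k) x = if j = k then 1 else 0 := by
    subst hcard
    exact exists_innerA_orthonormal F
  let a : Fin q → C(Torus n, ℂ) := fun l =>
    ⟨innerA n F h0 (e l), by unfold innerA; fun_prop⟩
  have ha (l : Fin q) (x : Torus n) (w : F) : a l (x - (w : Torus n)) = a l x :=
    sum_translate_sub F (fun y => h0 y * conj (e l y)) x w
  have hexp : ∑ l, a l * e l = h0 := by
    ext x
    simpa [a] using sum_innerA_mul_eq F (by simp [hcard]) he h0 x
  have ha1 (x : Torus n) : ∑ l, a l x * conj (a l x) = 1 := by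
    rw [← innerA_sum_mul F he ha ha x, hexp, hnorm]
  obtain ⟨U, hU0, hUF, hUU⟩ : ∃ U : Fin q → Fin q → C(Torus n, ℂ), U ⟨0, by omega⟩ = a ∧
      (∀ j l x, ∀ w : F, U j l (x - (w : Torus n)) = U j l x) ∧
      ∀ j k x, ∑ l, U j l x * conj (U k l x) = if j = k then 1 else 0 := by
    rcases hdim with h2 | hlt
    · exact exists_invariant_unitary_frame_two h2 F a ha ha1
    · exact exists_invariant_unitary_frame hq F (by omega) a ha ha1
  refine ⟨fun j => ∑ l, U j l * e l, ?_, fun j k => funext fun x => ?_⟩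
  · simp only [hU0, hexp]
  · rw [innerA_sum_mul F he (hUF j) (hUF k), hUU]
end
end

section
/- Let π : ℝ^n → 𝕋^n be the quotient map. Suppose h_0 ∈ B satisfies h_0(0) = 1 and ⟨h_0, h_0⟩ = 1, and suppose the lift h_0 ∘ π : ℝ^n → ℂ is infinitely differentiable (C^∞). If there exist continuous h_1, ..., h_{q-1} ∈ B such that h_0, h_1, ..., h_{q-1} is an orthonormal family, then there exist g_1, ..., g_{q-1} ∈ B such that h_0, g_1, ..., g_{q-1} is an orthonormal family and each lift g_j ∘ π is infinitely differentiable. -/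
open scoped Real ComplexConjugate
noncomputable section

/-- The lift `f ∘ π : ℝ^n → ℂ` of `f : 𝕋^n → ℂ` along the quotient map `π : ℝ^n → 𝕋^n`. -/
def liftRn {n : ℕ} (f : C(Torus n, ℂ)) : (Fin n → ℝ) → ℂ :=
  fun x => f fun i => ((x i : ℝ) : AddCircle (1 : ℝ))

section SmoothFilters

variable {n q : ℕ}

/-- The property that the lift to `ℝ^n` is infinitely differentiable. -/
def IsSmooth (f : C(Torus n, ℂ)) : Prop := ContDiff ℝ (⊤ : ℕ∞) (liftRn f)

/-- The map `x ↦ x - w` of the torus. -/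
def torusTranslate (w : Torus n) : C(Torus n, Torus n) := ⟨fun x => x - w, by fun_prop⟩

@[simp]
lemma torusTranslate_apply (w x : Torus n) : torusTranslate w x = x - w := rfl

namespace IsSmooth

variable {f g : C(Torus n, ℂ)}

lemma add (hf : IsSmooth f) (hg : IsSmooth g) : IsSmooth (f + g) := ContDiff.add hf hg

lemma neg (hf : IsSmooth f) : IsSmooth (-f) := ContDiff.neg hf

lemma mul (hf : IsSmooth f) (hg : IsSmooth g) : IsSmooth (f * g) := ContDiff.mul hf hg

lemma star (hf : IsSmooth f) : IsSmooth (star f) :=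
  Complex.conjCLE.contDiff.comp hf

lemma const (c : ℂ) : IsSmooth (ContinuousMap.const (Torus n) c) := contDiff_const

lemma sum {ι : Type*} (s : Finset ι) {f : ι → C(Torus n, ℂ)} (hf : ∀ i ∈ s, IsSmooth (f i)) :
    IsSmooth (∑ i ∈ s, f i) :=
  Finset.sum_induction _ _ (fun _ _ => add) (const 0) hf

lemma comp_torusTranslate (hf : IsSmooth f) (w : Torus n) : IsSmooth (f.comp (torusTranslate w)) := by
  choose v hv using fun i => QuotientAddGroup.mk_surjective (w i)
  have h : liftRn (f.comp (torusTranslate w)) = fun x => liftRn f (x - v) := by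
    funext x
    refine congrArg f (funext fun i => ?_)
    simp only [torusTranslate_apply, Pi.sub_apply, ← hv i]
    rfl
  unfold IsSmooth
  rw [h]
  exact ContDiff.comp (g := liftRn f) hf (contDiff_id.sub contDiff_const)

lemma mFourier (k : Fin n → ℤ) : IsSmooth (UnitAddTorus.mFourier k) := by
  have h : liftRn (UnitAddTorus.mFourier k) = fun x : Fin n → ℝ =>
      ∏ i, Complex.exp (2 * π * Complex.I * k i * (x i : ℝ) / (1 : ℝ)) := by
    funext x
    change ∏ i, fourier (k i) ((x i : ℝ) : AddCircle (1 : ℝ)) = _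
    simp only [fourier_coe_apply]
  unfold IsSmooth
  rw [h]
  refine contDiff_prod fun i _ => ContDiff.cexp (ContDiff.div_const (contDiff_const.mul ?_) _)
  exact Complex.ofRealCLM.contDiff.comp (contDiff_apply ℝ ℝ i)

lemma dense : Dense {f : C(Torus n, ℂ) | IsSmooth f} := by
  have h := UnitAddTorus.span_mFourier_closure_eq_top (d := Fin n)
  rw [← Submodule.dense_iff_topologicalClosure_eq_top] at h
  refine h.mono fun f hf => ?_
  induction hf using Submodule.span_induction with
  | mem f hf => obtain ⟨k, rfl⟩ := hf; exact mFourier k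
  | zero => exact const 0
  | add f g _ _ hf hg => exact add hf hg
  | smul c f _ hf => exact mul (const c) hf

/-- The inverse square root of a positive smooth function is smooth. -/
lemma exists_inv_sqrt (hf : IsSmooth f) (hpos : ∀ x, 0 < (f x).re) :
    ∃ N : C(Torus n, ℂ), IsSmooth N ∧ ∀ x, N x = ((√(f x).re)⁻¹ : ℝ) := by
  refine ⟨⟨fun x => ((√(f x).re)⁻¹ : ℝ), ?_⟩, ?_, fun _ => rfl⟩
  · have h : Continuous fun x => √(f x).re := by fun_prop
    exact Complex.continuous_ofReal.comp (h.inv₀ fun x => (Real.sqrt_pos.2 (hpos x)).ne')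
  · have h : ContDiff ℝ (⊤ : ℕ∞) fun x => (liftRn f x).re := Complex.reCLM.contDiff.comp hf
    exact Complex.ofRealCLM.contDiff.comp
      ((h.sqrt fun x => (hpos _).ne').inv fun x => (Real.sqrt_pos.2 (hpos _)).ne')

end IsSmooth

lemma mul_comp_torusTranslate (f g : C(Torus n, ℂ)) (w : Torus n) :
    (f * g).comp (torusTranslate w) = f.comp (torusTranslate w) * g.comp (torusTranslate w) := rfl

lemma sum_comp_torusTranslate {ι : Type*} (s : Finset ι) (f : ι → C(Torus n, ℂ)) (w : Torus n) :
    (∑ i ∈ s, f i).comp (torusTranslate w) = ∑ i ∈ s, (f i).comp (torusTranslate w) := by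
  ext x
  simp [ContinuousMap.sum_apply]

variable (F : AddSubgroup (Torus n))

/-- A function invariant under translation by `F`. -/
def IsTranslationInvariant (c : C(Torus n, ℂ)) : Prop := ∀ w : F, c.comp (torusTranslate w) = c

variable {F} (e : Fin q ≃ F)

/-- The matrix of translates by elements of `F` of a family of functions. -/
def filterMatrix (f : Fin q → C(Torus n, ℂ)) : Matrix (Fin q) (Fin q) C(Torus n, ℂ) :=
  Matrix.of fun j i => (f j).comp (torusTranslate (e i))

lemma continuous_filterMatrix : Continuous (filterMatrix (n := n) e) :=
  continuous_pi fun j => continuous_pi fun i =>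
    (ContinuousMap.continuous_precomp (torusTranslate (e i : Torus n))).comp (continuous_apply j)

lemma det_filterMatrix_update (f : Fin q → C(Torus n, ℂ)) (k : Fin q)
    {c : Fin q → C(Torus n, ℂ)} (hc : ∀ i, IsTranslationInvariant F (c i)) :
    (filterMatrix e (Function.update f k (∑ i, c i * f i))).det =
      c k * (filterMatrix e f).det := by
  rw [← smul_eq_mul, ← Matrix.det_updateRow_sum]
  congr 1
  ext1 j i
  rw [Matrix.updateRow_apply]
  split_ifs with hj
  · subst hj
    simp only [filterMatrix, Matrix.of_apply, Function.update_self, sum_comp_torusTranslate,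
      mul_comp_torusTranslate, Finset.sum_apply, Pi.smul_apply, smul_eq_mul]
    exact Finset.sum_congr rfl fun l _ => by rw [hc l (e i)]
  · simp [filterMatrix, Function.update_of_ne hj]

/-- A family with invertible matrix of translates and smooth member `j₀` can be replaced by a
smooth family with the same member `j₀` and invertible matrix of translates. -/
lemma exists_smooth_isUnit_det {h : Fin q → C(Torus n, ℂ)} (hdet : IsUnit (filterMatrix e h).det)
    (j₀ : Fin q) (hj₀ : IsSmooth (h j₀)) :
    ∃ f : Fin q → C(Torus n, ℂ), f j₀ = h j₀ ∧ (∀ j, IsSmooth (f j)) ∧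
      IsUnit (filterMatrix e f).det := by
  have hopen : IsOpen {f : Fin q → C(Torus n, ℂ) | IsUnit (filterMatrix e f).det} :=
    Units.isOpen.preimage (continuous_filterMatrix e).matrix_det
  set S : Fin q → Set C(Torus n, ℂ) := fun j => {f | IsSmooth f ∧ (j = j₀ → f = h j₀)} with hS
  have hmem : h ∈ closure (Set.univ.pi S) := by
    rw [closure_pi_set]
    intro j _
    rcases eq_or_ne j j₀ with rfl | hj
    · exact subset_closure ⟨hj₀, fun _ => rfl⟩
    · simpa [hS, hj] using IsSmooth.dense (h j)
  obtain ⟨f, hfdet, hfS⟩ := mem_closure_iff.1 hmem _ hopen hdet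
  exact ⟨f, (hfS j₀ trivial).2 rfl, fun j => (hfS j trivial).1, hfdet⟩

variable (F) [Fintype F]

/-- The inner product `innerA` as an element of `C(Torus n, ℂ)`. -/
def innerC (f g : C(Torus n, ℂ)) : C(Torus n, ℂ) :=
  ∑ w : F, f.comp (torusTranslate w) * star (g.comp (torusTranslate w))

lemma innerC_apply (f g : C(Torus n, ℂ)) (x : Torus n) :
    innerC F f g x = innerA n F f g x := by
  simp [innerC, innerA, ContinuousMap.sum_apply]

lemma isSmooth_innerC {f g : C(Torus n, ℂ)} (hf : IsSmooth f) (hg : IsSmooth g) :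
    IsSmooth (innerC F f g) :=
  IsSmooth.sum _ fun w _ => (hf.comp_torusTranslate w).mul (hg.comp_torusTranslate w).star

lemma star_innerC (f g : C(Torus n, ℂ)) : star (innerC F f g) = innerC F g f := by
  simp [innerC, mul_comm]

lemma isTranslationInvariant_innerC (f g : C(Torus n, ℂ)) : IsTranslationInvariant F (innerC F f g) := by
  intro w
  ext x
  simp only [innerC, ContinuousMap.comp_apply, torusTranslate_apply, ContinuousMap.sum_apply,
    ContinuousMap.mul_apply, ContinuousMap.star_apply]
  refine Fintype.sum_equiv (Equiv.addLeft w) _ _ fun u => ?_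
  simp [sub_sub]

lemma innerC_sum_mul {ι : Type*} (s : Finset ι) {c : ι → C(Torus n, ℂ)}
    (hc : ∀ i ∈ s, IsTranslationInvariant F (c i)) (f : ι → C(Torus n, ℂ)) (g : C(Torus n, ℂ)) :
    innerC F (∑ i ∈ s, c i * f i) g = ∑ i ∈ s, c i * innerC F (f i) g := by
  simp only [innerC, sum_comp_torusTranslate, Finset.sum_mul, Finset.mul_sum]
  rw [Finset.sum_comm]
  refine Finset.sum_congr rfl fun i hi => Finset.sum_congr rfl fun w _ => ?_
  rw [mul_comp_torusTranslate, hc i hi w, mul_assoc]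

lemma innerC_mul_left {c : C(Torus n, ℂ)} (hc : IsTranslationInvariant F c) (f g : C(Torus n, ℂ)) :
    innerC F (c * f) g = c * innerC F f g := by
  simpa using innerC_sum_mul F {()} (c := fun _ => c) (fun _ _ => hc) (fun _ => f) g

lemma innerC_mul_right {c : C(Torus n, ℂ)} (hc : IsTranslationInvariant F c) (f g : C(Torus n, ℂ)) :
    innerC F f (c * g) = star c * innerC F f g := by
  rw [← star_innerC, innerC_mul_left F hc, star_mul', star_innerC]

lemma innerC_self_apply (f : C(Torus n, ℂ)) (x : Torus n) :
    innerC F f f x = ((∑ w : F, ‖f (x - w)‖ ^ 2 : ℝ) : ℂ) := by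
  simp [innerC, ContinuousMap.sum_apply, Complex.mul_conj']

variable {F}

lemma filterMatrix_mul_conjTranspose (f : Fin q → C(Torus n, ℂ)) :
    filterMatrix e f * (filterMatrix e f).conjTranspose =
      Matrix.of fun j k => innerC F (f j) (f k) := by
  ext1 j k
  rw [Matrix.mul_apply]
  exact Fintype.sum_equiv e _ _ fun i => rfl

/-- If the matrix of translates is invertible, then no row vanishes at a point. -/
lemma innerC_self_pos {f : Fin q → C(Torus n, ℂ)} (hf : IsUnit (filterMatrix e f).det)
    (k : Fin q) (x : Torus n) : 0 < (innerC F (f k) (f k) x).re := by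
  rw [innerC_self_apply, Complex.ofReal_re]
  refine (Finset.sum_nonneg fun w _ => by positivity).lt_of_ne' fun h0 => ?_
  rw [Finset.sum_eq_zero_iff_of_nonneg fun w _ => by positivity] at h0
  refine (ContinuousMap.isUnit_iff_forall_ne_zero _).1 hf x ?_
  have hdet := RingHom.map_det (Pi.evalRingHom (fun _ => ℂ) x |>.comp ContinuousMap.coeFnRingHom)
    (filterMatrix e f)
  refine hdet.trans (Matrix.det_eq_zero_of_row_eq_zero k fun i => ?_)
  simpa [filterMatrix] using h0 (e i) (Finset.mem_univ _)

/-- One step of the Gram–Schmidt process over the invariant functions. -/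
lemma exists_orthonormal_succ {f : Fin q → C(Torus n, ℂ)} (hf : ∀ j, IsSmooth (f j))
    (hdet : IsUnit (filterMatrix e f).det) (k : Fin q)
    (horth : ∀ i < k, ∀ j < k, innerC F (f i) (f j) = if i = j then 1 else 0) :
    ∃ u : C(Torus n, ℂ), IsSmooth u ∧ IsUnit (filterMatrix e (Function.update f k u)).det ∧
      innerC F u u = 1 ∧ ∀ j < k, innerC F u (f j) = 0 := by
  set c : Fin q → C(Torus n, ℂ) := fun i =>
    if i < k then -innerC F (f k) (f i) else if i = k then 1 else 0 with hc
  have hinv : ∀ i, IsTranslationInvariant F (c i) := fun i w => by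
    simp only [hc]
    split_ifs
    · exact congrArg Neg.neg (isTranslationInvariant_innerC F (f k) (f i) w)
    · rfl
    · rfl
  have hcs : ∀ i, IsSmooth (c i) := fun i => by
    simp only [hc]
    split_ifs
    · exact (isSmooth_innerC F (hf k) (hf i)).neg
    · exact IsSmooth.const 1
    · exact IsSmooth.const 0
  have hck : c k = 1 := by simp [hc]
  set v := ∑ i, c i * f i with hv
  have hvs : IsSmooth v := IsSmooth.sum _ fun i _ => (hcs i).mul (hf i)
  have hvdet : IsUnit (filterMatrix e (Function.update f k v)).det := by
    rwa [det_filterMatrix_update e f k hinv, hck, one_mul]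
  have hvorth : ∀ j < k, innerC F v (f j) = 0 := fun j hj => by
    rw [hv, innerC_sum_mul F _ fun i _ => hinv i]
    have h : ∀ i, c i * innerC F (f i) (f j) =
        (if i = j then -innerC F (f k) (f j) else 0) +
          if i = k then innerC F (f k) (f j) else 0 := fun i => by
      rcases lt_trichotomy i k with hi | rfl | hi
      · simp only [hc, hi, if_true, horth i hi j hj, hi.ne, if_false, add_zero]
        split_ifs with hij
        · rw [hij, mul_one]
        · rw [mul_zero]
      · simp [hck, hj.ne']
      · simp [hc, hi.not_gt, hi.ne', (hj.trans hi).ne']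
    simp [h, Finset.sum_add_distrib]
  have hpos : ∀ x, 0 < (innerC F v v x).re := fun x => by
    simpa using innerC_self_pos e hvdet k x
  obtain ⟨N, hNs, hN⟩ := (isSmooth_innerC F hvs hvs).exists_inv_sqrt hpos
  have hNinv : IsTranslationInvariant F N := fun w => by
    ext x
    have := DFunLike.congr_fun (isTranslationInvariant_innerC F v v w) x
    simp only [ContinuousMap.comp_apply] at this ⊢
    rw [hN, hN, this]
  have hNunit : IsUnit N := by
    rw [ContinuousMap.isUnit_iff_forall_ne_zero]
    intro x
    rw [hN, Complex.ofReal_ne_zero]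
    exact inv_ne_zero (Real.sqrt_pos.2 (hpos x)).ne'
  refine ⟨N * v, hNs.mul hvs, ?_, ?_, fun j hj => ?_⟩
  · have h := det_filterMatrix_update e (Function.update f k v) k
      (c := Pi.single k N) fun i => by
        rcases eq_or_ne i k with rfl | hi
        · simpa using hNinv
        · rw [Pi.single_eq_of_ne hi]
          exact fun _ => rfl
    rw [Finset.sum_eq_single_of_mem k (Finset.mem_univ k) fun i _ hi => by
      rw [Pi.single_eq_of_ne hi, zero_mul]] at h
    simp only [Pi.single_eq_same, Function.update_self, Function.update_idem] at h
    rw [h]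
    exact hNunit.mul hvdet
  · rw [innerC_mul_left F hNinv, innerC_mul_right F hNinv]
    ext x
    have hre : innerC F v v x = ((innerC F v v x).re : ℂ) := by
      rw [innerC_self_apply, Complex.ofReal_re]
    have hs := Real.mul_self_sqrt (hpos x).le
    have hs0 := (Real.sqrt_pos.2 (hpos x)).ne'
    simp only [ContinuousMap.mul_apply, ContinuousMap.star_apply, hN, ContinuousMap.one_apply,
      RCLike.star_def, Complex.conj_ofReal]
    rw [hre, ← Complex.ofReal_mul, ← Complex.ofReal_mul, Complex.ofReal_eq_one, Complex.ofReal_re]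
    generalize √(innerC F v v x).re = s at hs hs0
    rw [← hs]
    field_simp
  · rw [innerC_mul_left F hNinv, hvorth j hj, mul_zero]

/-- Gram–Schmidt orthonormalization of the first `m` members of a smooth family whose matrix of
translates is invertible, keeping a normalized first member. -/
lemma exists_orthonormal_prefix (hq : 0 < q) {f : Fin q → C(Torus n, ℂ)}
    (hf : ∀ j, IsSmooth (f j)) (hdet : IsUnit (filterMatrix e f).det)
    (hnorm : innerC F (f ⟨0, hq⟩) (f ⟨0, hq⟩) = 1) (m : ℕ) (hm : m + 1 ≤ q) :
    ∃ g : Fin q → C(Torus n, ℂ), g ⟨0, hq⟩ = f ⟨0, hq⟩ ∧ (∀ j, IsSmooth (g j)) ∧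
      IsUnit (filterMatrix e g).det ∧
      ∀ i j : Fin q, (i : ℕ) < m + 1 → (j : ℕ) < m + 1 →
        innerC F (g i) (g j) = if i = j then 1 else 0 := by
  induction m with
  | zero =>
    refine ⟨f, rfl, hf, hdet, fun i j hi hj => ?_⟩
    obtain rfl : i = ⟨0, hq⟩ := Fin.ext (by simpa using hi)
    obtain rfl : j = ⟨0, hq⟩ := Fin.ext (by simpa using hj)
    simpa using hnorm
  | succ m ih =>
    obtain ⟨g, hg0, hgs, hgdet, hgo⟩ := ih (by omega)
    obtain ⟨k, hk⟩ : ∃ k : Fin q, (k : ℕ) = m + 1 := ⟨⟨m + 1, by omega⟩, rfl⟩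
    have hlt : ∀ i : Fin q, i < k ↔ (i : ℕ) < m + 1 := fun i => by rw [Fin.lt_def, hk]
    obtain ⟨u, hus, hudet, huu, huo⟩ := exists_orthonormal_succ e hgs hgdet k
      fun i hi j hj => hgo i j ((hlt i).1 hi) ((hlt j).1 hj)
    have hcases : ∀ i : Fin q, (i : ℕ) < m + 1 + 1 → i < k ∨ i = k := fun i hi => by
      rw [Fin.lt_def, Fin.ext_iff]
      omega
    refine ⟨Function.update g k u, ?_, fun j => ?_, hudet, fun i j hi hj => ?_⟩
    · rw [Function.update_of_ne (Fin.ne_of_lt ((hlt _).2 m.succ_pos)), hg0]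
    · rcases eq_or_ne j k with rfl | hj
      · simpa using hus
      · simpa [Function.update_of_ne hj] using hgs j
    · rcases hcases i hi with hi | rfl <;> rcases hcases j hj with hj | hj
      · rw [Function.update_of_ne hi.ne, Function.update_of_ne hj.ne]
        exact hgo i j ((hlt i).1 hi) ((hlt j).1 hj)
      · subst hj
        rw [Function.update_of_ne hi.ne, Function.update_self, ← star_innerC, huo i hi, star_zero,
          if_neg hi.ne]
      · rw [Function.update_of_ne hj.ne, Function.update_self, huo j hj, if_neg hj.ne']
      · subst hj
        simpa using huu

end SmoothFilters

/-- If a normalized low-pass filter `h_0` is infinitely differentiable (its lift to `ℝ^n`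
is `C^∞`) and admits some family of continuous high-pass filters, then it admits a family
of infinitely differentiable high-pass filters. -/
theorem exists_smooth_highpass_filters (n q : ℕ) (hn : 1 ≤ n) (hq : 2 ≤ q)
    (F : AddSubgroup (Torus n)) [Fintype F] (hcard : Fintype.card F = q)
    (h0 : C(Torus n, ℂ)) (hlow : h0 0 = 1)
    (hnorm : innerA n F h0 h0 = fun _ => 1)
    (hsmooth : ContDiff ℝ (⊤ : ℕ∞) (liftRn h0))
    (h : Fin q → C(Torus n, ℂ)) (hh0 : h ⟨0, by omega⟩ = h0)
    (horth : ∀ j k, innerA n F (h j) (h k) = fun _ => if j = k then (1 : ℂ) else 0) :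
    ∃ g : Fin q → C(Torus n, ℂ), g ⟨0, by omega⟩ = h0 ∧
      (∀ j k, innerA n F (g j) (g k) = fun _ => if j = k then (1 : ℂ) else 0) ∧
      ∀ j, ContDiff ℝ (⊤ : ℕ∞) (liftRn (g j)) := by
  have hq0 : 0 < q := by omega
  let e : Fin q ≃ F := (Fintype.equivFinOfCardEq hcard).symm
  have hC : ∀ j k, innerC F (h j) (h k) = if j = k then 1 else 0 := fun j k => by
    ext x
    rw [innerC_apply, horth]
    split_ifs <;> rfl
  have hdet : IsUnit (filterMatrix e h).det := by
    refine Matrix.isUnit_det_of_right_inverse (B := (filterMatrix e h).conjTranspose) ?_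
    rw [filterMatrix_mul_conjTranspose]
    ext1 j k
    rw [Matrix.of_apply, hC, Matrix.one_apply]
  obtain ⟨f, hf0, hfs, hfdet⟩ := exists_smooth_isUnit_det e hdet ⟨0, hq0⟩
    (show IsSmooth _ by rw [hh0]; exact hsmooth)
  obtain ⟨g, hg0, hgs, -, hgo⟩ := exists_orthonormal_prefix e hq0 hfs hfdet
    (by rw [hf0, hC, if_pos rfl]) (q - 1) (by omega)
  refine ⟨g, hg0.trans (hf0.trans hh0), fun j k => funext fun x => ?_, hgs⟩
  rw [← innerC_apply, hgo j k (by omega) (by omega)]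
  split_ifs <;> rfl
end
end

section
/- For every v ∈ ℂ² and r ∈ ℝ with ‖v‖² + r² = 1, the 2 × 2 complex matrix U_0(v, r) = I_2 − 2(1 + ir)^{-2} v v* is unitary. -/
open scoped ComplexConjugate
noncomputable section

/-- The matrix `U_0(v, r) = I_2 − 2(1 + ir)^{-2} v v*`. -/
def U0mat (v : Fin 2 → ℂ) (r : ℝ) : Matrix (Fin 2) (Fin 2) ℂ :=
  Matrix.of fun j k =>
    (if j = k then (1 : ℂ) else 0) - 2 * ((1 + Complex.I * r) ^ 2)⁻¹ * v j * conj (v k)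

/-- A rank-one perturbation `1 - c v v*` of the identity is unitary as soon as
`c + c̄ = c c̄ ‖v‖²`. -/
theorem one_sub_smul_vecMulVec_star_mem_unitaryGroup {n : Type*} [Fintype n] [DecidableEq n]
    {v : n → ℂ} {c : ℂ} (h : c + conj c = c * conj c * (star v ⬝ᵥ v)) :
    1 - c • Matrix.vecMulVec v (star v) ∈ Matrix.unitaryGroup n ℂ := by
  have hsq : Matrix.vecMulVec v (star v) * Matrix.vecMulVec v (star v) =
      (star v ⬝ᵥ v) • Matrix.vecMulVec v (star v) := by
    rw [Matrix.vecMulVec_mul_vecMulVec, Matrix.vecMulVec_smul]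
  have hstar : star (Matrix.vecMulVec v (star v)) = Matrix.vecMulVec v (star v) := by
    rw [Matrix.star_eq_conjTranspose, Matrix.conjTranspose_vecMulVec, star_star]
  rw [Matrix.mem_unitaryGroup_iff, star_sub, star_one, star_smul, hstar, sub_mul, mul_sub, mul_sub,
    smul_mul_smul_comm, hsq, smul_smul, mul_one, one_mul, mul_one]
  rw [Complex.star_def, ← h]
  module

/-- For `w = 1 + ir`, the scalar `c = 2 w⁻²` satisfies `c + c̄ = c c̄ (1 - r²)`. -/
theorem two_mul_inv_sq_add_conj (r : ℝ) :
    2 * ((1 + Complex.I * r) ^ 2)⁻¹ + conj (2 * ((1 + Complex.I * r) ^ 2)⁻¹) =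
      2 * ((1 + Complex.I * r) ^ 2)⁻¹ * conj (2 * ((1 + Complex.I * r) ^ 2)⁻¹) *
        (1 - (r : ℂ) ^ 2) := by
  have h₁ : (1 + Complex.I * r : ℂ) ≠ 0 := fun h => by simpa using congrArg Complex.re h
  have h₂ : (1 - Complex.I * r : ℂ) ≠ 0 := fun h => by simpa using congrArg Complex.re h
  simp only [map_mul, map_inv₀, map_pow, map_add, map_one, Complex.conj_I, Complex.conj_ofReal,
    map_ofNat, neg_mul, ← sub_eq_add_neg]
  field_simp
  linear_combination (2 * (r : ℂ) ^ 2) * Complex.I_sq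

/-- For `(v, r) ∈ S^4 ⊂ ℂ² × ℝ` (i.e. `‖v‖² + r² = 1`), the matrix
`U_0(v, r) = I_2 − 2(1 + ir)^{-2} v v*` is unitary. -/
theorem U0_unitary (v : Fin 2 → ℂ) (r : ℝ)
    (hvr : ∑ i, Complex.normSq (v i) + r ^ 2 = 1) :
    U0mat v r ∈ Matrix.unitaryGroup (Fin 2) ℂ := by
  have hnorm : star v ⬝ᵥ v = 1 - (r : ℂ) ^ 2 := by
    rw [eq_sub_iff_add_eq]
    calc star v ⬝ᵥ v + (r : ℂ) ^ 2 = ((∑ i, Complex.normSq (v i) + r ^ 2 : ℝ) : ℂ) := by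
          simp [dotProduct, Complex.normSq_eq_conj_mul_self]
      _ = 1 := by rw [hvr, Complex.ofReal_one]
  have hU : U0mat v r =
      1 - (2 * ((1 + Complex.I * r) ^ 2)⁻¹) • Matrix.vecMulVec v (star v) := by
    ext j k
    simp [U0mat, Matrix.one_apply, Matrix.vecMulVec_apply, mul_assoc]
  rw [hU]
  apply one_sub_smul_vecMulVec_star_mem_unitaryGroup
  rw [hnorm]
  exact two_mul_inv_sq_add_conj r
end
end

section
/- For every v ∈ ℂ² and ξ ∈ ℂ with ‖v‖² + |ξ|² = 1 and ξ ≠ 1, the 3 × 3 complex block matrix φ⁻(v, ξ) = [[I_2 − (1 − conj(ξ))^{-1} v v*, v], [c(ξ) v*, ξ]], where c(ξ) = (1 − ξ)(1 − conj(ξ))^{-1}, is unitary. -/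
open scoped ComplexConjugate
noncomputable section

/-- The block matrix `φ⁻(v, ξ) = [[I_2 − (1 − conj ξ)⁻¹ v v*, v], [c(ξ) v*, ξ]]` with
`c(ξ) = (1 − ξ)(1 − conj ξ)⁻¹`. -/
def phiMinus (v : Fin 2 → ℂ) (ξ : ℂ) : Matrix (Fin 3) (Fin 3) ℂ :=
  !![1 - (1 - conj ξ)⁻¹ * v 0 * conj (v 0), -((1 - conj ξ)⁻¹ * v 0 * conj (v 1)), v 0;
     -((1 - conj ξ)⁻¹ * v 1 * conj (v 0)), 1 - (1 - conj ξ)⁻¹ * v 1 * conj (v 1), v 1;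
     (1 - ξ) * (1 - conj ξ)⁻¹ * conj (v 0), (1 - ξ) * (1 - conj ξ)⁻¹ * conj (v 1), ξ]

/-- For `v ∈ ℂ²`, `ξ ∈ ℂ` with `‖v‖² + |ξ|² = 1` and `ξ ≠ 1`, the matrix `φ⁻(v, ξ)`
is unitary. -/
theorem phiMinus_unitary (v : Fin 2 → ℂ) (ξ : ℂ)
    (hvξ : ∑ i, Complex.normSq (v i) + Complex.normSq ξ = 1) (hξ : ξ ≠ 1) :
    phiMinus v ξ ∈ Matrix.unitaryGroup (Fin 3) ℂ := by
  have h : v 0 * conj (v 0) + v 1 * conj (v 1) + ξ * conj ξ = 1 := by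
    simp only [Complex.mul_conj, ← Complex.ofReal_add]
    rw [Fin.sum_univ_two] at hvξ
    rw [hvξ, Complex.ofReal_one]
  have h₁ : 1 - ξ ≠ 0 := sub_ne_zero.mpr hξ.symm
  have h₂ : 1 - conj ξ ≠ 0 := by
    intro h0
    apply h₁
    simpa using congrArg conj h0
  rw [Matrix.mem_unitaryGroup_iff, Matrix.star_eq_conjTranspose]
  have hcorner : (1 - conj ξ)⁻¹ + (1 - ξ)⁻¹
      - (1 - conj ξ)⁻¹ * (1 - ξ)⁻¹ * (v 0 * conj (v 0) + v 1 * conj (v 1)) = 1 := by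
    field_simp
    linear_combination -h
  have hcol : (1 - conj ξ) * (1 - ξ)⁻¹
      * (1 - (1 - conj ξ)⁻¹ * (v 0 * conj (v 0) + v 1 * conj (v 1))) = -conj ξ := by
    field_simp
    linear_combination -h
  have hrow : (1 - ξ) * (1 - conj ξ)⁻¹
      * (1 - (1 - ξ)⁻¹ * (v 0 * conj (v 0) + v 1 * conj (v 1))) = -ξ := by
    field_simp
    linear_combination -h
  have hphase : (1 - ξ) * (1 - conj ξ)⁻¹ * ((1 - conj ξ) * (1 - ξ)⁻¹) = 1 := by
    field_simp
  ext i j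
  fin_cases i <;> fin_cases j <;>
    simp [phiMinus, Matrix.mul_apply, Fin.sum_univ_three]
  · linear_combination (-(v 0 * conj (v 0))) * hcorner
  · linear_combination (-(v 0 * conj (v 1))) * hcorner
  · linear_combination v 0 * hcol
  · linear_combination (-(v 1 * conj (v 0))) * hcorner
  · linear_combination (-(v 1 * conj (v 1))) * hcorner
  · linear_combination v 1 * hcol
  · linear_combination conj (v 0) * hrow
  · linear_combination conj (v 1) * hrow
  · linear_combination (v 0 * conj (v 0) + v 1 * conj (v 1)) * hphase + h
end
end

section
/- Let S⁴ = {(v, r) ∈ ℂ² × ℝ : ‖v‖² + r² = 1}. The continuous map from S⁴ into the unitary group U(3) ⊂ M_3(ℂ) given by (v, r) ↦ diag(U_0(v, r), 1), where U_0(v, r) = I_2 − 2(1 + ir)^{-2} v v* and diag(U_0(v, r), 1) is the block-diagonal 3 × 3 matrix with (2,2)-entry 1, is homotopic, through continuous maps from S⁴ into U(3), to the constant map with value the identity matrix I_3. -/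
open scoped ComplexConjugate unitInterval
noncomputable section

/-- The 4-sphere `S⁴ = {(v, r) ∈ ℂ² × ℝ : ‖v‖² + r² = 1}`. -/
abbrev Sphere4 : Type :=
  { p : (Fin 2 → ℂ) × ℝ // ∑ i, Complex.normSq (p.1 i) + p.2 ^ 2 = 1 }

/-- The block-diagonal matrix `diag(U_0(v, r), 1) ∈ M_3(ℂ)`. -/
def diagU0 (v : Fin 2 → ℂ) (r : ℝ) : Matrix (Fin 3) (Fin 3) ℂ :=
  !![U0mat v r 0 0, U0mat v r 0 1, 0;
     U0mat v r 1 0, U0mat v r 1 1, 0;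
     0, 0, 1]

/-- The matrix `I - 2(1 + iρ)^{-2} w w*`, which is unitary when `‖w‖² + ρ² = 1`. -/
def rankOnePerturbation {n : Type*} [DecidableEq n] (w : n → ℂ) (ρ : ℝ) : Matrix n n ℂ :=
  1 - (2 * ((1 + Complex.I * ρ) ^ 2)⁻¹) • Matrix.vecMulVec w (star w)

theorem rankOnePerturbation_apply {n : Type*} [DecidableEq n] (w : n → ℂ) (ρ : ℝ) (i j : n) :
    rankOnePerturbation w ρ i j =
      (1 : Matrix n n ℂ) i j - 2 * ((1 + Complex.I * ρ) ^ 2)⁻¹ * (w i * conj (w j)) :=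
  rfl

theorem one_add_I_mul_ofReal_ne_zero (ρ : ℝ) : (1 + Complex.I * ρ : ℂ) ≠ 0 := by
  intro h
  simpa using congrArg Complex.re h

theorem rankOnePerturbation_mem_unitaryGroup {n : Type*} [DecidableEq n] [Fintype n]
    (w : n → ℂ) (ρ : ℝ) (h : star w ⬝ᵥ w = 1 - (ρ : ℂ) ^ 2) :
    rankOnePerturbation w ρ ∈ Matrix.unitaryGroup n ℂ := by
  rw [Matrix.mem_unitaryGroup_iff]
  have hz := one_add_I_mul_ofReal_ne_zero ρ
  have hz' : (1 - Complex.I * ρ : ℂ) ≠ 0 := by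
    simpa [sub_eq_add_neg] using one_add_I_mul_ofReal_ne_zero (-ρ)
  have hA : star (Matrix.vecMulVec w (star w)) = Matrix.vecMulVec w (star w) := by
    rw [Matrix.star_eq_conjTranspose, Matrix.conjTranspose_vecMulVec, star_star]
  have hAA : Matrix.vecMulVec w (star w) * Matrix.vecMulVec w (star w) =
      (1 - (ρ : ℂ) ^ 2) • Matrix.vecMulVec w (star w) := by
    rw [Matrix.vecMulVec_mul_vecMulVec, h, Matrix.vecMulVec_smul]
  have hc : star (2 * ((1 + Complex.I * (ρ : ℂ)) ^ 2)⁻¹) =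
      2 * ((1 - Complex.I * (ρ : ℂ)) ^ 2)⁻¹ := by
    simp [sub_eq_add_neg]
  have key : 2 * ((1 + Complex.I * (ρ : ℂ)) ^ 2)⁻¹ + 2 * ((1 - Complex.I * (ρ : ℂ)) ^ 2)⁻¹ =
      2 * ((1 + Complex.I * (ρ : ℂ)) ^ 2)⁻¹ * (2 * ((1 - Complex.I * (ρ : ℂ)) ^ 2)⁻¹) *
        (1 - (ρ : ℂ) ^ 2) := by
    field_simp
    linear_combination 2 * (ρ : ℂ) ^ 2 * Complex.I_sq
  rw [rankOnePerturbation, star_sub, star_one, star_smul, hA, hc, sub_mul, mul_sub, mul_sub,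
    smul_mul_smul_comm, hAA, smul_smul, ← key]
  simp only [one_mul, mul_one]
  module

/-- The height `r` is moved linearly to the pole `1`. -/
def poleHeight (t r : ℝ) : ℝ := r + t * (1 - r)

/-- The squared modulus of the third coordinate of `contractingVector`. -/
def contractingVectorSq (t r : ℝ) : ℝ :=
  2 * (t * (1 - t) * (1 - r))

theorem contractingVectorSq_nonneg {t r : ℝ} (ht : t ∈ Set.Icc (0 : ℝ) 1) (hr : r ≤ 1) :
    0 ≤ contractingVectorSq t r :=
  mul_nonneg zero_le_two
    (mul_nonneg (mul_nonneg ht.1 (sub_nonneg.2 ht.2)) (sub_nonneg.2 hr))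

/-- A vector in `ℂ³` of squared norm `1 - (poleHeight t r)²` which is `(v, 0)` at `t = 0`
and vanishes at `t = 1`. -/
def contractingVector (t : ℝ) (v : Fin 2 → ℂ) (r : ℝ) : Fin 3 → ℂ :=
  ![(1 - t : ℝ) * v 0, (1 - t : ℝ) * v 1, (√(contractingVectorSq t r) : ℝ)]

theorem star_contractingVector_dotProduct {t : ℝ} (ht : t ∈ Set.Icc (0 : ℝ) 1) (p : Sphere4) :
    star (contractingVector t p.1.1 p.1.2) ⬝ᵥ contractingVector t p.1.1 p.1.2 =
      1 - (poleHeight t p.1.2 : ℂ) ^ 2 := by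
  obtain ⟨⟨v, r⟩, hp⟩ := p
  simp only [Fin.sum_univ_two] at hp
  have hr : r ≤ 1 := by
    nlinarith [Complex.normSq_nonneg (v 0), Complex.normSq_nonneg (v 1)]
  have hs : (√(contractingVectorSq t r) : ℂ) ^ 2 = 2 * (t * (1 - t) * (1 - (r : ℂ))) := by
    have := Real.sq_sqrt (contractingVectorSq_nonneg ht hr)
    conv_rhs at this => rw [contractingVectorSq]
    exact_mod_cast this
  have hp' : conj (v 0) * v 0 + conj (v 1) * v 1 + (r : ℂ) ^ 2 = 1 := by
    rw [← Complex.normSq_eq_conj_mul_self, ← Complex.normSq_eq_conj_mul_self]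
    exact_mod_cast hp
  simp [contractingVector, poleHeight, dotProduct, Fin.sum_univ_three]
  linear_combination hs + (1 - (t : ℂ)) ^ 2 * hp'

theorem continuous_rankOnePerturbation_contractingVector :
    Continuous fun x : I × Sphere4 =>
      rankOnePerturbation (contractingVector x.1 x.2.1.1 x.2.1.2) (poleHeight x.1 x.2.1.2) := by
  have hw : Continuous fun x : I × Sphere4 => contractingVector x.1 x.2.1.1 x.2.1.2 := by
    refine continuous_pi fun i => ?_
    fin_cases i <;>
      simp only [contractingVector, contractingVectorSq] <;> simp <;> fun_prop
  have hρ : Continuous fun x : I × Sphere4 =>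
      2 * ((1 + Complex.I * (poleHeight x.1 x.2.1.2 : ℂ)) ^ 2)⁻¹ := by
    refine continuous_const.mul (Continuous.inv₀ ?_ fun x =>
      pow_ne_zero 2 (one_add_I_mul_ofReal_ne_zero _))
    unfold poleHeight
    fun_prop
  exact continuous_const.sub (hρ.smul (hw.matrix_vecMulVec hw.star))

/-- The map `S⁴ → U(3)`, `(v, r) ↦ diag(U_0(v, r), 1)`, is homotopic through continuous
maps from `S⁴` into the unitary group `U(3)` to the constant map with value `I_3`. -/
theorem diagU0_nullhomotopic_in_unitaryGroup :
    ∃ H : C(I × Sphere4, Matrix (Fin 3) (Fin 3) ℂ),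
      (∀ (t : I) (p : Sphere4), H (t, p) ∈ Matrix.unitaryGroup (Fin 3) ℂ) ∧
      (∀ p : Sphere4, H (0, p) = diagU0 p.1.1 p.1.2) ∧
      (∀ p : Sphere4, H (1, p) = 1) := by
  refine ⟨⟨_, continuous_rankOnePerturbation_contractingVector⟩, fun t p => ?_, fun p => ?_,
    fun p => ?_⟩
  · exact rankOnePerturbation_mem_unitaryGroup _ _ (star_contractingVector_dotProduct t.2 p)
  · ext i j
    fin_cases i <;> fin_cases j <;>
      simp [rankOnePerturbation_apply, contractingVector, contractingVectorSq, poleHeight, diagU0,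
        U0mat, mul_assoc]
  · ext i j
    fin_cases i <;> fin_cases j <;>
      simp [rankOnePerturbation_apply, contractingVector, contractingVectorSq, poleHeight]
end
end
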